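/- Let G be a finite abelian group, F a field with Ω_F acting trivially on G, h ∈ Hom(Ω_F,G), and a ∈ F_h. Then F_h = FG·a (i.e. a generates F_h as a free rank-one FG-module) if and only if the resolvend r_G(a) is a unit in the group algebra F̄G. -/

import Mathlib

/-- The fixed field of the kernel of `h` determines that kernel, for `h` continuous. -/
theorem map_eq_one_of_forall_fixedField_ker {F L G : Type*} [Field F] [Field L] [Algebra F L]
    [IsGalois F L] [Group G] (h : (L ≃ₐ[F] L) →* G)
    (hcont : ∃ E : IntermediateField F L, FiniteDimensional F E ∧
      ∀ ω : L ≃ₐ[F] L, (∀ x ∈ E, ω x = x) → h ω = 1)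
    (ω : L ≃ₐ[F] L) (hω : ∀ x ∈ IntermediateField.fixedField h.ker, ω x = x) : h ω = 1 := by
  obtain ⟨E, hE, hker⟩ := hcont
  have hle : E.fixingSubgroup ≤ h.ker := fun σ hσ =>
    hker σ ((IntermediateField.mem_fixingSubgroup_iff E σ).1 hσ)
  have hclosed : IsClosed (h.ker : Set (L ≃ₐ[F] L)) :=
    Subgroup.isClosed_of_isOpen _ (Subgroup.isOpen_mono hle E.fixingSubgroup_isOpen)
  have hmem : ω ∈ (IntermediateField.fixedField h.ker).fixingSubgroup :=
    (IntermediateField.mem_fixingSubgroup_iff _ ω).2 hω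
  have hfix := InfiniteGalois.fixingSubgroup_fixedField (⟨h.ker, hclosed⟩ : ClosedSubgroup _)
  exact hfix.le hmem

/-- An element of the fixed field of `h.ker` extends to an equivariant map supported on a given
coset of the range of `h`. -/
theorem exists_equivariant_of_mem_fixedField_ker {F L G : Type*} [Field F] [Field L] [Algebra F L]
    [Group G] (h : (L ≃ₐ[F] L) →* G) (g : G) {x : L}
    (hx : x ∈ IntermediateField.fixedField h.ker) :
    ∃ b : G → L, (∀ (ω : L ≃ₐ[F] L) (s : G), b (h ω * s) = ω (b s)) ∧
      (∀ ω, b (h ω * g) = ω x) ∧ ∀ s ∉ h.range, b (s * g) = 0 := by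
  classical
  have hwd (ω ω' : L ≃ₐ[F] L) (hωω' : h ω = h ω') : ω x = ω' x := by
    have := (IntermediateField.mem_fixedField_iff _ _).1 hx (ω'⁻¹ * ω)
      (by simp [MonoidHom.mem_ker, hωω'])
    simpa using congrArg ω' this
  let b : G → L := fun s => if hs : ∃ ω, h ω * g = s then hs.choose x else 0
  have hb (ω : L ≃ₐ[F] L) : b (h ω * g) = ω x := by
    have hs : ∃ ω', h ω' * g = h ω * g := ⟨ω, rfl⟩
    simp only [b, dif_pos hs]
    exact hwd _ _ (mul_right_cancel hs.choose_spec)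
  have hb0 (s : G) (hs : ¬ ∃ ω, h ω * g = s) : b s = 0 := dif_neg hs
  refine ⟨b, fun ω s => ?_, hb, fun s hs => hb0 _ ?_⟩
  · by_cases hs : ∃ ω', h ω' * g = s
    · obtain ⟨ω', rfl⟩ := hs
      rw [← mul_assoc, ← map_mul, hb, hb, AlgEquiv.mul_apply]
    · rw [hb0 s hs, map_zero]
      refine hb0 _ ?_
      rintro ⟨ω', hω'⟩
      exact hs ⟨ω⁻¹ * ω', by rw [map_mul, mul_assoc, hω', map_inv, inv_mul_cancel_left]⟩
  · rintro ⟨ω, hω⟩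
    exact hs ⟨ω, mul_right_cancel hω⟩

/-- The equivariant maps `G → L` span all maps `G → L` over `L`. -/
theorem span_equivariant_eq_top {F L G : Type*} [Field F] [Field L] [Algebra F L]
    [IsGalois F L] [Group G] [Fintype G] (h : (L ≃ₐ[F] L) →* G)
    (hcont : ∃ E : IntermediateField F L, FiniteDimensional F E ∧
      ∀ ω : L ≃ₐ[F] L, (∀ x ∈ E, ω x = x) → h ω = 1) :
    Submodule.span L {b : G → L | ∀ (ω : L ≃ₐ[F] L) (s : G), b (h ω * s) = ω (b s)} = ⊤ := by
  classical
  by_contra hne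
  obtain ⟨φ, hφ, hle⟩ := Submodule.exists_le_ker_of_lt_top _ (lt_top_iff_ne_top.2 hne)
  let K := IntermediateField.fixedField h.ker
  choose σ hσ using fun k : h.range => k.2
  let χ : h.range → K →* L := fun k => ((σ k : L →* L)).comp (K.val : K →* L)
  have hχ : Function.Injective χ := fun k k' hkk' => by
    have hone : h ((σ k')⁻¹ * σ k) = 1 := by
      refine map_eq_one_of_forall_fixedField_ker h hcont _ fun x hx => ?_
      have : σ k x = σ k' x := DFunLike.congr_fun hkk' (⟨x, hx⟩ : K)
      rw [AlgEquiv.mul_apply, this]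
      exact (σ k').symm_apply_apply x
    rw [map_mul, map_inv, hσ, hσ, inv_mul_eq_one] at hone
    exact Subtype.ext hone.symm
  have hind := Fintype.linearIndependent_iff.1 ((linearIndependent_monoidHom K L).comp χ hχ)
  refine hφ (LinearMap.ext fun v => ?_)
  rw [LinearMap.pi_apply_eq_sum_univ, LinearMap.zero_apply]
  refine Finset.sum_eq_zero fun g _ => ?_
  have hzero := hind (fun k => φ fun j => if (k : G) * g = j then 1 else 0) (by
    ext x
    obtain ⟨b, hb, hbx, hb0⟩ := exists_equivariant_of_mem_fixedField_ker h g x.2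
    have hφb : φ b = 0 := hle (Submodule.subset_span hb)
    rw [LinearMap.pi_apply_eq_sum_univ, ← Equiv.sum_comp (Equiv.mulRight g),
      ← Finset.sum_filter_of_ne (p := (· ∈ h.range)) (by
        intro s _ hs
        by_contra hmem
        exact hs (by simp [hb0 s hmem])),
      Finset.sum_subtype (p := (· ∈ h.range)) _ (by simp)] at hφb
    rw [Finset.sum_apply, Pi.zero_apply]
    refine (Finset.sum_congr rfl fun k _ => ?_).trans hφb
    have hk : b (k * g) = σ k x := by rw [← hσ k, hbx]
    simp only [Pi.smul_apply, smul_eq_mul, Equiv.coe_mulRight, hk]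
    exact mul_comm _ _) 1
  simp only [OneMemClass.coe_one, one_mul] at hzero
  rw [hzero, smul_zero]

/-- The resolvend `∑ s, a s • s⁻¹` of a map `a : G → L`, as a linear map. -/
noncomputable def resolvend (L G : Type*) [Field L] [CommGroup G] [Fintype G] :
    (G → L) →ₗ[L] MonoidAlgebra L G where
  toFun a := ∑ s : G, MonoidAlgebra.single s⁻¹ (a s)
  map_add' a b := by simp [MonoidAlgebra.single_add, Finset.sum_add_distrib]
  map_smul' c a := by simp [Finset.smul_sum]

theorem coeff_resolvend {L G : Type*} [Field L] [CommGroup G] [Fintype G] (a : G → L) (t : G) :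
    (resolvend L G a).coeff t = a t⁻¹ := by
  classical
  simp [resolvend, MonoidAlgebra.coeff_sum, Finsupp.single_apply, inv_eq_iff_eq_inv]

theorem coeff_mul_resolvend {L G : Type*} [Field L] [CommGroup G] [Fintype G]
    (γ : MonoidAlgebra L G) (a : G → L) (t : G) :
    (γ * resolvend L G a).coeff t⁻¹ = ∑ s : G, γ.coeff s * a (t * s) := by
  rw [MonoidAlgebra.coeff_mul_apply_left, Finsupp.sum_fintype _ _ (by simp)]
  refine Finset.sum_congr rfl fun s _ => ?_
  rw [coeff_resolvend]
  simp

/-- Applying `ω` to the coefficients of the resolvend of an equivariant map multiplies it by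
`h ω`. -/
theorem mapRingHom_resolvend {F L G : Type*} [Field F] [Field L] [Algebra F L]
    [CommGroup G] [Fintype G] (h : (L ≃ₐ[F] L) →* G) {a : G → L}
    (ha : ∀ (ω : L ≃ₐ[F] L) (s : G), a (h ω * s) = ω (a s)) (ω : L ≃ₐ[F] L) :
    MonoidAlgebra.mapRingHom G (ω : L →+* L) (resolvend L G a) =
      resolvend L G a * MonoidAlgebra.single (h ω) 1 := by
  ext t
  simp [coeff_resolvend, ← ha]


/-- (McCulloh, Prop. 1.8.)  Let `L/F` be a Galois extension
(modelling `F̄/F`) with group `Ω = L ≃ₐ[F] L`, `G` a finite abelian group with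
trivial `Ω`-action, and `h : Ω →* G` continuous (its kernel contains the subgroup
fixing a finite-dimensional subfield).  Let `a` be an element of the Galois algebra
`F_h = Map_Ω(^hG, L)`.  Then `F_h = FG·a` — every `b ∈ F_h` is of the form
`(Σ_s c_s s)·a` with coefficients `c_s ∈ F`, where `(s·a)(t) = a(ts)` — if and only
if the resolvend `r_G(a) = Σ_s a(s)·s⁻¹` is a unit of the group algebra `LG`. -/
theorem stmt_9 {F L G : Type*} [Field F] [Field L] [Algebra F L] [IsGalois F L]
    [CommGroup G] [Fintype G]
    (h : (L ≃ₐ[F] L) →* G)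
    (hcont : ∃ E : IntermediateField F L, FiniteDimensional F E ∧
      ∀ ω : L ≃ₐ[F] L, (∀ x ∈ E, ω x = x) → h ω = 1)
    (a : G → L) (ha : ∀ (ω : L ≃ₐ[F] L) (s : G), a (h ω * s) = ω (a s)) :
    (∀ b : G → L, (∀ (ω : L ≃ₐ[F] L) (s : G), b (h ω * s) = ω (b s)) →
        ∃ c : G → F, ∀ t : G, b t = ∑ s : G, algebraMap F L (c s) * a (t * s)) ↔
      IsUnit (∑ s : G, MonoidAlgebra.single s⁻¹ (a s) : MonoidAlgebra L G) := by
  change _ ↔ IsUnit (resolvend L G a)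
  constructor
  · intro hgen
    have hdvd (b : G → L) : resolvend L G a ∣ resolvend L G b := by
      have hb : b ∈ Submodule.span L
          {b : G → L | ∀ (ω : L ≃ₐ[F] L) (s : G), b (h ω * s) = ω (b s)} :=
        span_equivariant_eq_top h hcont ▸ Submodule.mem_top
      induction hb using Submodule.span_induction with
      | mem b hb =>
        obtain ⟨c, hc⟩ := hgen b hb
        refine Dvd.intro_left
          (MonoidAlgebra.ofCoeff (Finsupp.equivFunOnFinite.symm fun s => algebraMap F L (c s))) ?_
        ext t
        rw [← inv_inv t, coeff_mul_resolvend, coeff_resolvend, inv_inv, hc]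
        rfl
      | zero => simp
      | add b b' _ _ hb hb' => rw [map_add]; exact dvd_add hb hb'
      | smul c b _ hb => rw [map_smul]; exact dvd_smul_of_dvd c hb
    classical
    refine isUnit_of_dvd_one ?_
    convert hdvd (Pi.single 1 1)
    ext t
    rw [coeff_resolvend, MonoidAlgebra.one_def, MonoidAlgebra.coeff_single]
    simp [Finsupp.single_apply, Pi.single_apply, eq_comm]
  · intro hunit b hb
    obtain ⟨γ, hγ⟩ := hunit.dvd (a := resolvend L G b)
    have hfix (ω : L ≃ₐ[F] L) : MonoidAlgebra.mapRingHom G (ω : L →+* L) γ = γ := by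
      have hω := congrArg (MonoidAlgebra.mapRingHom G (ω : L →+* L)) hγ
      rw [map_mul, mapRingHom_resolvend h ha, mapRingHom_resolvend h hb, hγ, mul_right_comm] at hω
      have hs : IsUnit (MonoidAlgebra.single (h ω) 1 : MonoidAlgebra L G) :=
        (Group.isUnit (h ω)).map (MonoidAlgebra.of L G)
      exact ((hunit.mul hs).mul_left_cancel hω).symm
    have hcoeff (s : G) : ∃ c : F, algebraMap F L c = γ.coeff s :=
      (InfiniteGalois.mem_range_algebraMap_iff_fixed _).2 fun ω => by
        simpa using congrArg (fun x => x.coeff s) (hfix ω)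
    choose c hc using hcoeff
    refine ⟨c, fun t => ?_⟩
    simp_rw [hc]
    rw [← coeff_mul_resolvend, mul_comm, ← hγ, coeff_resolvend, inv_inv]
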